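/- Let d ≥ 1, let ‖·‖ be an arbitrary norm on ℝ^d, and for x ∈ ℝ^d define the induced torus distance ‖x‖_T := min_{k ∈ ℤ^d} ‖x − k‖. Let (x_n)_{n≥1} be a low-discrepancy sequence in [0,1)^d, i.e. there is a constant C > 0 with D_N*(x_n) ≤ C (log N)^d / N for all N ≥ 2. Then for every α with 0 < α < 1/d² and every s > 0, lim_{N→∞} #{(l,m) : 1 ≤ l, m ≤ N, l ≠ m, ‖x_l − x_m‖_T ≤ s/N^{α}} / ( N² · λ_d(B_{‖·‖}(0, s/N^{α})) ) = 1, where λ_d(B_{‖·‖}(0,r)) is the Lebesgue volume of the ball of radius r of the norm ‖·‖ in ℝ^d. -/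

import Mathlib

open scoped Classical

/-- Star-discrepancy of the first `N` points of `x` in `[0,1)^d`: supremum over all
anchored boxes `[0,b) ⊆ [0,1)^d` of `|#{1 ≤ n ≤ N : x_n ∈ [0,b)}/N - vol [0,b)|`. -/
noncomputable def starDiscrepancy (d N : ℕ) (x : ℕ → Fin d → ℝ) : ℝ :=
  sSup {v : ℝ | ∃ b : Fin d → ℝ, (∀ i, 0 < b i ∧ b i ≤ 1) ∧
    v = |(((Finset.Icc 1 N).filter (fun n => ∀ i, 0 ≤ x n i ∧ x n i < b i)).card : ℝ) / N
      - ∏ i, b i|}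

/-- Torus distance induced by a norm `nrm` on `ℝ^d`: `min_{k ∈ ℤ^d} nrm (y - k)`. -/
noncomputable def torusDist {d : ℕ} (nrm : (Fin d → ℝ) → ℝ) (y : Fin d → ℝ) : ℝ :=
  ⨅ k : Fin d → ℤ, nrm (fun i => y i - (k i : ℝ))

lemma anchored_bound (d N : ℕ) (x : ℕ → Fin d → ℝ) (hx : ∀ n, ∀ i, x n i ∈ Set.Ico (0 : ℝ) 1)
    (E : ℝ) (hE : starDiscrepancy d N x ≤ E) (b : Fin d → ℝ) (hb : ∀ i, 0 ≤ b i ∧ b i ≤ 1) :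
    |(((Finset.Icc 1 N).filter (fun n => ∀ i, x n i < b i)).card : ℝ) / N - ∏ i, b i| ≤ E := by
  have hE0 : 0 ≤ E := by
    refine le_trans ?_ hE
    apply Real.sSup_nonneg
    rintro v ⟨b, -, rfl⟩
    positivity
  by_cases h : ∃ i, b i = 0
  · obtain ⟨i, hi⟩ := h
    have h1 : (Finset.Icc 1 N).filter (fun n => ∀ i, x n i < b i) = ∅ := by
      apply Finset.filter_false_of_mem
      intro n _ hn
      have := hn i
      have := (hx n i).1
      linarith
    rw [h1, Finset.prod_eq_zero (Finset.mem_univ i) hi]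
    simpa using hE0
  · push Not at h
    refine le_trans ?_ hE
    apply le_csSup
    · refine ⟨2, ?_⟩
      rintro v ⟨b, hb, rfl⟩
      have h1 : (((Finset.Icc 1 N).filter (fun n => ∀ i, 0 ≤ x n i ∧ x n i < b i)).card : ℝ) / N ≤ 1 := by
        apply div_le_one_of_le₀ _ (by positivity)
        have := Finset.card_filter_le (Finset.Icc 1 N) (fun n => ∀ i, 0 ≤ x n i ∧ x n i < b i)
        simp only [Nat.card_Icc, Nat.add_sub_cancel] at this
        exact_mod_cast this
      have h2 : 0 ≤ (((Finset.Icc 1 N).filter (fun n => ∀ i, 0 ≤ x n i ∧ x n i < b i)).card : ℝ) / N := by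
        positivity
      have h3 : 0 ≤ ∏ i, b i := Finset.prod_nonneg fun i _ => (hb i).1.le
      have h4 : ∏ i, b i ≤ 1 := Finset.prod_le_one (fun i _ => (hb i).1.le) fun i _ => (hb i).2
      rw [abs_le]; constructor <;> linarith
    · refine ⟨b, fun i => ⟨lt_of_le_of_ne (hb i).1 (h i).symm, (hb i).2⟩, ?_⟩
      congr 5
      ext n
      simp only [Finset.mem_filter]
      refine and_congr_right fun _ => forall_congr' fun i => ?_
      simp [(hx n i).1]

lemma box_bound (d N : ℕ) (x : ℕ → Fin d → ℝ) (hx : ∀ n, ∀ i, x n i ∈ Set.Ico (0 : ℝ) 1)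
    (E : ℝ) (hE : starDiscrepancy d N x ≤ E) (lo hi : Fin d → ℝ)
    (hlo : ∀ i, 0 ≤ lo i) (hlh : ∀ i, lo i ≤ hi i) (hhi : ∀ i, hi i ≤ 1) :
    |(((Finset.Icc 1 N).filter (fun n => ∀ i, lo i ≤ x n i ∧ x n i < hi i)).card : ℝ) / N
      - ∏ i, (hi i - lo i)| ≤ 2 ^ d * E := by
  set b : Finset (Fin d) → Fin d → ℝ := fun t i => if i ∈ t then lo i else hi i with hb
  have key : ∀ f g : Fin d → ℝ, ∏ i, (f i - g i) =
      ∑ t : Finset (Fin d), (-1 : ℝ) ^ t.card * ∏ i, (if i ∈ t then g i else f i) := by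
    intro f g
    have h1 : ∏ i, (f i - g i) = ∏ i, (-g i + f i) := by
      refine Finset.prod_congr rfl fun i _ => by ring
    rw [h1, Finset.prod_add, Finset.powerset_univ]
    refine Finset.sum_congr rfl fun t _ => ?_
    rw [Finset.prod_ite, Finset.prod_neg, mul_assoc]
    congr 3
    · ext i; simp
    · ext i; simp
  have hc : (((Finset.Icc 1 N).filter (fun n => ∀ i, lo i ≤ x n i ∧ x n i < hi i)).card : ℝ)
      = ∑ t : Finset (Fin d), (-1 : ℝ) ^ t.card *
        (((Finset.Icc 1 N).filter (fun n => ∀ i, x n i < b t i)).card : ℝ) := by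
    have h1 : ∀ b : Fin d → ℝ, (((Finset.Icc 1 N).filter (fun n => ∀ i, x n i < b i)).card : ℝ)
        = ∑ n ∈ Finset.Icc 1 N, ∏ i, (if x n i < b i then (1:ℝ) else 0) := by
      intro b
      rw [Finset.card_filter]
      push_cast
      refine Finset.sum_congr rfl fun n _ => ?_
      rw [Finset.prod_ite_zero]
      simp
    have h2 : (((Finset.Icc 1 N).filter (fun n => ∀ i, lo i ≤ x n i ∧ x n i < hi i)).card : ℝ)
        = ∑ n ∈ Finset.Icc 1 N, ∏ i, ((if x n i < hi i then (1:ℝ) else 0) - (if x n i < lo i then (1:ℝ) else 0)) := by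
      rw [Finset.card_filter]
      push_cast
      refine Finset.sum_congr rfl fun n _ => ?_
      have : ∀ i, ((if x n i < hi i then (1:ℝ) else 0) - (if x n i < lo i then (1:ℝ) else 0))
        = if (lo i ≤ x n i ∧ x n i < hi i) then 1 else 0 := by
        intro i
        have := hlh i
        split_ifs <;> grind
      simp_rw [this]
      rw [Finset.prod_ite_zero]
      simp
    rw [h2]
    simp_rw [h1, key, Finset.mul_sum]
    rw [Finset.sum_comm]
    refine Finset.sum_congr rfl fun t _ => Finset.sum_congr rfl fun n _ => ?_
    congr 1
    refine Finset.prod_congr rfl fun i _ => ?_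
    simp only [hb]
    split_ifs <;> rfl
  rw [hc, key, Finset.sum_div, ← Finset.sum_sub_distrib]
  refine (Finset.abs_sum_le_sum_abs _ _).trans ?_
  have : ∀ t ∈ (Finset.univ : Finset (Finset (Fin d))), |(-1 : ℝ) ^ t.card *
        (((Finset.Icc 1 N).filter (fun n => ∀ i, x n i < b t i)).card : ℝ) / N -
        (-1 : ℝ) ^ t.card * ∏ i, (if i ∈ t then lo i else hi i)| ≤ E := by
    intro t _
    rw [mul_div_assoc, ← mul_sub, abs_mul, abs_pow, abs_neg, abs_one, one_pow, one_mul]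
    apply anchored_bound d N x hx E hE (b t)
    intro i
    simp only [hb]
    have := hlo i
    have := hlh i
    have := hhi i
    split_ifs <;> constructor <;> linarith
  refine (Finset.sum_le_sum this).trans ?_
  simp

/-- Points of the sequence in the cell `k` (mod `M`). -/
noncomputable def cellPts (d N M : ℕ) (x : ℕ → Fin d → ℝ) (k : Fin d → ℤ) : Finset ℕ :=
  (Finset.Icc 1 N).filter (fun n => ∀ i, ⌊(M : ℝ) * x n i⌋ = k i % (M : ℤ))

lemma cell_bound (d N M : ℕ) (hM : 0 < M) (x : ℕ → Fin d → ℝ)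
    (hx : ∀ n, ∀ i, x n i ∈ Set.Ico (0 : ℝ) 1)
    (E : ℝ) (hE : starDiscrepancy d N x ≤ E) (k : Fin d → ℤ) :
    |((cellPts d N M x k).card : ℝ) / N - 1 / (M : ℝ) ^ d| ≤ 2 ^ d * E := by
  have hM' : (0 : ℝ) < M := by exact_mod_cast hM
  have h0 : ∀ i, (0 : ℝ) ≤ ((k i % (M : ℤ) : ℤ) : ℝ) := fun i => by
    exact_mod_cast Int.emod_nonneg _ (by omega)
  have h1 : ∀ i, ((k i % (M : ℤ) : ℤ) : ℝ) + 1 ≤ M := fun i => by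
    have := Int.emod_lt_of_pos (k i) (b := (M : ℤ)) (by omega)
    exact_mod_cast this
  have := box_bound d N x hx E hE (fun i => ((k i % (M : ℤ) : ℤ) : ℝ) / M)
    (fun i => (((k i % (M : ℤ) : ℤ) : ℝ) + 1) / M) (fun i => by have := h0 i; positivity)
    (fun i => by gcongr; linarith) (fun i => by rw [div_le_one hM']; exact h1 i)
  convert this using 3
  · congr 3
    ext n
    simp only [cellPts, Finset.mem_filter]
    refine and_congr_right fun _ => forall_congr' fun i => ?_
    rw [Int.floor_eq_iff, div_le_iff₀ hM', lt_div_iff₀ hM', mul_comm]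
  · have : ∀ i, (((k i % (M : ℤ) : ℤ) : ℝ) + 1) / M - ((k i % (M : ℤ) : ℤ) : ℝ) / M = 1 / M := by
      intro i; ring
    simp [this]

structure IsNrm {d : ℕ} (nrm : (Fin d → ℝ) → ℝ) : Prop where
  zero : ∀ y, nrm y = 0 ↔ y = 0
  smul : ∀ (c : ℝ) (y : Fin d → ℝ), nrm (c • y) = |c| * nrm y
  tri : ∀ y w : Fin d → ℝ, nrm (y + w) ≤ nrm y + nrm w

namespace IsNrm

variable {d : ℕ} {nrm : (Fin d → ℝ) → ℝ}

lemma neg (h : IsNrm nrm) (y : Fin d → ℝ) : nrm (-y) = nrm y := by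
  have := h.smul (-1) y
  simpa using this

lemma nonneg (h : IsNrm nrm) (y : Fin d → ℝ) : 0 ≤ nrm y := by
  have h1 := h.tri y (-y)
  rw [h.neg, add_neg_cancel, (h.zero 0).2 rfl] at h1
  linarith

lemma tri_sub (h : IsNrm nrm) (y w z : Fin d → ℝ) : nrm (y - z) ≤ nrm (y - w) + nrm (w - z) := by
  have := h.tri (y - w) (w - z)
  simpa using this

lemma sub_comm (h : IsNrm nrm) (y w : Fin d → ℝ) : nrm (y - w) = nrm (w - y) := by
  rw [← h.neg, neg_sub]

lemma sum_le (h : IsNrm nrm) (s : Finset (Fin d)) (f : Fin d → Fin d → ℝ) :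
    nrm (∑ i ∈ s, f i) ≤ ∑ i ∈ s, nrm (f i) := by
  induction s using Finset.induction_on with
  | empty => simp [(h.zero 0).2 rfl]
  | insert a s ha ih =>
    rw [Finset.sum_insert ha, Finset.sum_insert ha]
    exact (h.tri _ _).trans (by linarith)

lemma upper (h : IsNrm nrm) : ∃ c : ℝ, 0 < c ∧ ∀ y, nrm y ≤ c * ‖y‖ := by
  refine ⟨∑ i, nrm (Pi.single i 1) + 1, ?_, ?_⟩
  · have : 0 ≤ ∑ i, nrm (Pi.single i (1:ℝ)) := Finset.sum_nonneg fun i _ => h.nonneg _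
    linarith
  intro y
  have h1 : y = ∑ i, (y i) • (Pi.single i (1:ℝ) : Fin d → ℝ) := by
    ext j
    simp [Finset.sum_apply, Pi.single_apply]
  have h2 : nrm y ≤ ∑ i, nrm ((y i) • (Pi.single i (1:ℝ) : Fin d → ℝ)) := by
    conv_lhs => rw [h1]
    exact h.sum_le _ _
  have h3 : ∑ i, nrm ((y i) • (Pi.single i (1:ℝ) : Fin d → ℝ)) ≤ ∑ i, ‖y‖ * nrm (Pi.single i (1:ℝ)) := by
    refine Finset.sum_le_sum fun i _ => ?_
    rw [h.smul]
    exact mul_le_mul_of_nonneg_right (norm_le_pi_norm y i) (h.nonneg _)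
  rw [← Finset.mul_sum] at h3
  have := norm_nonneg y
  nlinarith

lemma cont (h : IsNrm nrm) : Continuous nrm := by
  obtain ⟨c, hc, hcy⟩ := h.upper
  have : LipschitzWith ⟨c, hc.le⟩ nrm := by
    apply LipschitzWith.of_le_add_mul
    intro y w
    have h1 := h.tri (y - w) w
    have h2 := hcy (y - w)
    rw [sub_add_cancel] at h1
    rw [dist_eq_norm]
    change nrm y ≤ nrm w + c * _
    linarith
  exact this.continuous

lemma lower (h : IsNrm nrm) : ∃ c : ℝ, 0 < c ∧ ∀ y, ‖y‖ ≤ c * nrm y := by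
  by_cases hne : (Metric.sphere (0 : Fin d → ℝ) 1).Nonempty
  · obtain ⟨z, hz, hmin⟩ := (isCompact_sphere (0 : Fin d → ℝ) 1).exists_isMinOn hne h.cont.continuousOn
    have hz1 : ‖z‖ = 1 := by simpa using hz
    have hz0 : 0 < nrm z := by
      refine lt_of_le_of_ne (h.nonneg z) fun h0 => ?_
      rw [(h.zero z).1 h0.symm] at hz1
      simp at hz1
    refine ⟨(nrm z)⁻¹, by positivity, fun y => ?_⟩
    by_cases hy : y = 0
    · subst hy; simp [(h.zero 0).2 rfl]
    have hy' : 0 < ‖y‖ := norm_pos_iff.2 hy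
    have h1 : (‖y‖⁻¹ • y) ∈ Metric.sphere (0 : Fin d → ℝ) 1 := by
      simp [norm_smul, hy'.ne']
    have h2 : nrm z ≤ nrm (‖y‖⁻¹ • y) := hmin h1
    rw [h.smul, abs_of_pos (by positivity), inv_mul_eq_div, le_div_iff₀ hy'] at h2
    rw [inv_mul_eq_div, le_div_iff₀ hz0]
    linarith
  · refine ⟨1, one_pos, fun y => ?_⟩
    by_cases hy : y = 0
    · subst hy; simp [(h.zero 0).2 rfl]
    have hy' : 0 < ‖y‖ := norm_pos_iff.2 hy
    exact absurd ⟨‖y‖⁻¹ • y, by simp [norm_smul, hy'.ne']⟩ hne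

open MeasureTheory

lemma vol_lt_top (h : IsNrm nrm) (ρ : ℝ) : volume {y : Fin d → ℝ | nrm y ≤ ρ} < ⊤ := by
  obtain ⟨c, hc, hcy⟩ := h.lower
  refine (measure_mono ?_).trans_lt (measure_closedBall_lt_top (x := (0 : Fin d → ℝ)) (r := c * ρ))
  intro y hy
  rw [mem_closedBall_zero_iff]
  have : nrm y ≤ ρ := hy
  exact (hcy y).trans (by gcongr)

lemma vol_pos (h : IsNrm nrm) : 0 < (volume {y : Fin d → ℝ | nrm y ≤ 1}).toReal := by
  refine ENNReal.toReal_pos ?_ (h.vol_lt_top 1).ne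
  obtain ⟨c, hc, hcy⟩ := h.upper
  refine ((Metric.measure_ball_pos volume (0 : Fin d → ℝ) (r := c⁻¹) (by positivity)).trans_le
    (measure_mono ?_)).ne'
  intro y hy
  rw [mem_ball_zero_iff] at hy
  have := hcy y
  have h2 : c * ‖y‖ ≤ c * c⁻¹ := by gcongr
  rw [mul_inv_cancel₀ hc.ne'] at h2
  exact this.trans h2

open scoped Pointwise in
lemma vol_eq (h : IsNrm nrm) (ρ : ℝ) (hρ : 0 < ρ) : (volume {y : Fin d → ℝ | nrm y ≤ ρ}).toReal
    = ρ ^ d * (volume {y : Fin d → ℝ | nrm y ≤ 1}).toReal := by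
  have h1 : {y : Fin d → ℝ | nrm y ≤ ρ} = ρ • {y : Fin d → ℝ | nrm y ≤ 1} := by
    ext y
    rw [Set.mem_smul_set_iff_inv_smul_mem₀ hρ.ne']
    simp only [Set.mem_ofPred_eq, h.smul, abs_of_pos (inv_pos.2 hρ)]
    rw [inv_mul_le_iff₀ hρ, mul_one]
  rw [h1, Measure.addHaar_smul, ENNReal.toReal_mul, ENNReal.toReal_ofReal (abs_nonneg _)]
  simp [abs_of_pos hρ]

lemma vol_sub (a : Fin d → ℝ) (ρ : ℝ) : volume {y : Fin d → ℝ | nrm (y - a) ≤ ρ} =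
    volume {y : Fin d → ℝ | nrm y ≤ ρ} := by
  have := measure_preimage_add_right volume (-a) {y : Fin d → ℝ | nrm y ≤ ρ}
  simp only [sub_eq_add_neg]
  exact this

end IsNrm

/-- Grid cell. -/
def gridCell (d M : ℕ) (k : Fin d → ℤ) : Set (Fin d → ℝ) := {y | ∀ i, ⌊(M : ℝ) * y i⌋ = k i}

lemma gridCell_eq (d M : ℕ) (hM : 0 < M) (k : Fin d → ℤ) : gridCell d M k =
    Set.pi Set.univ fun i => Set.Ico ((k i : ℝ) / M) (((k i : ℝ) + 1) / M) := by
  have hM' : (0 : ℝ) < M := by exact_mod_cast hM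
  ext y
  simp only [gridCell, Set.mem_ofPred_eq, Set.mem_pi, Set.mem_univ, true_imp_iff, Set.mem_Ico]
  refine forall_congr' fun i => ?_
  rw [Int.floor_eq_iff, div_le_iff₀ hM', lt_div_iff₀ hM', mul_comm]

lemma gridCell_vol (d M : ℕ) (hM : 0 < M) (k : Fin d → ℤ) :
    MeasureTheory.volume (gridCell d M k) = ENNReal.ofReal (1 / (M : ℝ) ^ d) := by
  have hM' : (0 : ℝ) < M := by exact_mod_cast hM
  rw [gridCell_eq d M hM, Real.volume_pi_Ico, ← ENNReal.ofReal_prod_of_nonneg]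
  · congr 1
    have : ∀ i, ((k i : ℝ) + 1) / M - (k i : ℝ) / M = 1 / M := by
      intro i; ring
    simp [this]
  · intro i _
    rw [← sub_div]; simp

lemma gridCell_meas (d M : ℕ) (hM : 0 < M) (k : Fin d → ℤ) :
    MeasurableSet (gridCell d M k) := by
  rw [gridCell_eq d M hM]
  exact MeasurableSet.univ_pi fun i => measurableSet_Ico

lemma gridCell_dist (d M : ℕ) (hM : 0 < M) (k : Fin d → ℤ) (y w : Fin d → ℝ)
    (hy : y ∈ gridCell d M k) (hw : w ∈ gridCell d M k) : ‖y - w‖ ≤ 1 / M := by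
  have hM' : (0 : ℝ) < M := by exact_mod_cast hM
  rw [pi_norm_le_iff_of_nonneg (by positivity)]
  intro i
  have h1 := Int.abs_sub_lt_one_of_floor_eq_floor ((hy i).trans (hw i).symm)
  rw [Pi.sub_apply, Real.norm_eq_abs, le_div_iff₀ hM']
  rw [← mul_sub, abs_mul, abs_of_pos hM'] at h1
  linarith

/-- Cells meeting a ball. -/
def cellsMeeting {d : ℕ} (nrm : (Fin d → ℝ) → ℝ) (M : ℕ) (a : Fin d → ℝ) (ρ : ℝ) :
    Set (Fin d → ℤ) := {k | ∃ y ∈ gridCell d M k, nrm (y - a) ≤ ρ}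

section
variable {d : ℕ} {nrm : (Fin d → ℝ) → ℝ}

lemma cellsMeeting_finite (h : IsNrm nrm) (M : ℕ) (a : Fin d → ℝ) (ρ : ℝ) :
    (cellsMeeting nrm M a ρ).Finite := by
  obtain ⟨c, hc, hcy⟩ := h.lower
  apply (Set.finite_Icc (fun _ : Fin d => ⌊-((M : ℝ) * (‖a‖ + c * ρ))⌋)
    (fun _ : Fin d => ⌊(M : ℝ) * (‖a‖ + c * ρ)⌋)).subset
  rintro k ⟨y, hy, hya⟩
  have h1 : ‖y‖ ≤ ‖a‖ + c * ρ := by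
    have h2 := hcy (y - a)
    have h3 : c * nrm (y - a) ≤ c * ρ := by gcongr
    have h4 := norm_le_insert' y a
    linarith
  have h2 : ∀ i, |(M : ℝ) * y i| ≤ M * (‖a‖ + c * ρ) := by
    intro i
    rw [abs_mul, abs_of_nonneg (by positivity : (0:ℝ) ≤ M)]
    have := norm_le_pi_norm y i
    rw [Real.norm_eq_abs] at this
    gcongr
    linarith
  refine ⟨fun i => ?_, fun i => ?_⟩
  · rw [← hy i]
    exact Int.floor_le_floor (abs_le.1 (h2 i)).1
  · rw [← hy i]
    exact Int.floor_le_floor (abs_le.1 (h2 i)).2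

lemma cells_upper (h : IsNrm nrm) (c : ℝ) (hc : 0 < c) (hcy : ∀ y, nrm y ≤ c * ‖y‖)
    (M : ℕ) (hM : 0 < M) (a : Fin d → ℝ) (ρ : ℝ) (hρ : 0 < ρ) :
    ((cellsMeeting_finite h M a ρ).toFinset.card : ℝ) / (M : ℝ) ^ d ≤
      (ρ + c / M) ^ d * (MeasureTheory.volume {y : Fin d → ℝ | nrm y ≤ 1}).toReal := by
  have hM' : (0 : ℝ) < M := by exact_mod_cast hM
  rw [← h.vol_eq _ (by positivity), ← IsNrm.vol_sub a]
  have h1 : (⋃ k ∈ (cellsMeeting_finite h M a ρ).toFinset, gridCell d M k) ⊆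
      {y : Fin d → ℝ | nrm (y - a) ≤ ρ + c / M} := by
    intro y hy
    simp only [Set.mem_iUnion, Set.Finite.mem_toFinset] at hy
    obtain ⟨k, ⟨w, hw, hwa⟩, hy⟩ := hy
    have h2 := h.tri_sub y w a
    have h3 := hcy (y - w)
    have h4 := gridCell_dist d M hM k y w hy hw
    have h5 : c * ‖y - w‖ ≤ c * (1 / M) := by gcongr
    rw [mul_one_div] at h5
    change nrm (y - a) ≤ ρ + c / M
    linarith
  have h2 := ENNReal.toReal_mono (by rw [IsNrm.vol_sub]; exact (h.vol_lt_top _).ne)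
    (MeasureTheory.measure_mono (μ := MeasureTheory.volume) h1)
  rw [MeasureTheory.measure_biUnion_finset] at h2
  · simp only [gridCell_vol d M hM, Finset.sum_const, nsmul_eq_mul, ENNReal.toReal_mul,
      ENNReal.toReal_natCast] at h2
    rw [ENNReal.toReal_ofReal (by positivity)] at h2
    rw [div_eq_mul_one_div]
    exact h2
  · intro k _ k' _ hkk
    apply Set.disjoint_left.2
    intro y hy hy'
    exact hkk (funext fun i => (hy i).symm.trans (hy' i))
  · intro k _
    exact gridCell_meas d M hM k

lemma cells_lower (h : IsNrm nrm)
    (M : ℕ) (hM : 0 < M) (a : Fin d → ℝ) (ρ : ℝ) (hρ : 0 < ρ) :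
    ρ ^ d * (MeasureTheory.volume {y : Fin d → ℝ | nrm y ≤ 1}).toReal ≤
    ((cellsMeeting_finite h M a ρ).toFinset.card : ℝ) / (M : ℝ) ^ d := by
  have hM' : (0 : ℝ) < M := by exact_mod_cast hM
  rw [← h.vol_eq _ (by positivity), ← IsNrm.vol_sub a]
  have h1 : {y : Fin d → ℝ | nrm (y - a) ≤ ρ} ⊆
      (⋃ k ∈ (cellsMeeting_finite h M a ρ).toFinset, gridCell d M k) := by
    intro y hy
    simp only [Set.mem_iUnion, Set.Finite.mem_toFinset]
    exact ⟨fun i => ⌊(M : ℝ) * y i⌋, ⟨y, fun i => rfl, hy⟩, fun i => rfl⟩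
  have h2 := (MeasureTheory.measure_mono (μ := MeasureTheory.volume) h1).trans
    (MeasureTheory.measure_biUnion_finset_le _ _)
  simp only [gridCell_vol d M hM, Finset.sum_const, nsmul_eq_mul] at h2
  have h3 := ENNReal.toReal_mono (by finiteness) h2
  rw [ENNReal.toReal_mul, ENNReal.toReal_natCast, ENNReal.toReal_ofReal (by positivity)] at h3
  rw [div_eq_mul_one_div]
  exact h3

/-- Points close to `a` in the torus. -/
noncomputable def closePts (nrm : (Fin d → ℝ) → ℝ) (N : ℕ) (x : ℕ → Fin d → ℝ) (a : Fin d → ℝ)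
    (r : ℝ) : Finset ℕ :=
  (Finset.Icc 1 N).filter fun l => torusDist nrm (fun i => x l i - a i) ≤ r

lemma close_upper (h : IsNrm nrm) (N M : ℕ) (hM : 0 < M) (x : ℕ → Fin d → ℝ)
    (hx : ∀ n, ∀ i, x n i ∈ Set.Ico (0 : ℝ) 1) (a : Fin d → ℝ) (r δ : ℝ) (hδ : 0 < δ) :
    closePts nrm N x a r ⊆
      (cellsMeeting_finite h M a (r + δ)).toFinset.biUnion (cellPts d N M x) := by
  have hM' : (0 : ℝ) < M := by exact_mod_cast hM
  intro l hl
  simp only [closePts, Finset.mem_filter] at hl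
  obtain ⟨hl, hlr⟩ := hl
  obtain ⟨k, hk⟩ := exists_lt_of_ciInf_lt (lt_of_le_of_lt hlr (lt_add_of_pos_right r hδ))
  simp only [Finset.mem_biUnion, Set.Finite.mem_toFinset, cellPts, Finset.mem_filter]
  have hfl : ∀ i, ⌊(M : ℝ) * (x l i - k i)⌋ = ⌊(M : ℝ) * x l i⌋ - M * k i := by
    intro i
    rw [← Int.floor_sub_intCast]
    push_cast
    rw [mul_sub]
  refine ⟨fun i => ⌊(M : ℝ) * (x l i - k i)⌋, ⟨fun i => x l i - k i, fun i => rfl, ?_⟩, hl, ?_⟩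
  · refine le_of_eq_of_le ?_ hk.le
    congr 1
    ext i
    simp only [Pi.sub_apply]
    ring
  · intro i
    simp only [hfl]
    rw [Int.sub_mul_emod_self_left, Int.emod_eq_of_lt]
    · exact Int.floor_nonneg.2 (mul_nonneg hM'.le (hx l i).1)
    · rw [Int.floor_lt]
      have := (hx l i).2
      push_cast
      nlinarith

lemma cell_shift (h : IsNrm nrm) (c : ℝ) (hc : 0 < c) (hcy : ∀ y, nrm y ≤ c * ‖y‖)
    (N M : ℕ) (hM : 0 < M) (x : ℕ → Fin d → ℝ) (a : Fin d → ℝ) (r : ℝ) (k : Fin d → ℤ)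
    (hk : k ∈ cellsMeeting nrm M a (r - c / M)) (l : ℕ) (hl : l ∈ cellPts d N M x k) :
    nrm (fun i => x l i - a i - ((-(k i / (M : ℤ)) : ℤ) : ℝ)) ≤ r := by
  have hM' : (0 : ℝ) < M := by exact_mod_cast hM
  obtain ⟨y, hy, hya⟩ := hk
  simp only [cellPts, Finset.mem_filter] at hl
  have hw : (fun i => x l i + ((k i / (M : ℤ) : ℤ) : ℝ)) ∈ gridCell d M k := by
    intro i
    have h1 : (M : ℝ) * (x l i + ((k i / (M : ℤ) : ℤ) : ℝ)) =
        (M : ℝ) * x l i + (((M : ℤ) * (k i / (M : ℤ)) : ℤ) : ℝ) := by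
      push_cast; ring
    simp only [h1]
    rw [Int.floor_add_intCast, hl.2 i, Int.emod_add_mul_ediv]
  have h2 := gridCell_dist d M hM k _ y hw hy
  have h3 := hcy ((fun i => x l i + ((k i / (M : ℤ) : ℤ) : ℝ)) - y)
  have h4 := h.tri_sub (fun i => x l i + ((k i / (M : ℤ) : ℤ) : ℝ)) y a
  have h5 := mul_le_mul_of_nonneg_left h2 hc.le
  rw [mul_one_div] at h5
  have h6 : (fun i => x l i - a i - ((-(k i / (M : ℤ)) : ℤ) : ℝ)) =
      (fun i => x l i + ((k i / (M : ℤ) : ℤ) : ℝ)) - a := by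
    ext i
    simp only [Pi.sub_apply]
    push_cast
    ring
  rw [h6]
  linarith

lemma close_lower (h : IsNrm nrm) (c : ℝ) (hc : 0 < c) (hcy : ∀ y, nrm y ≤ c * ‖y‖)
    (N M : ℕ) (hM : 0 < M) (x : ℕ → Fin d → ℝ) (a : Fin d → ℝ) (r : ℝ) :
    (cellsMeeting_finite h M a (r - c / M)).toFinset.biUnion (cellPts d N M x) ⊆
    closePts nrm N x a r := by
  intro l hl
  simp only [Finset.mem_biUnion, Set.Finite.mem_toFinset] at hl
  obtain ⟨k, hk, hl⟩ := hl
  have h1 := cell_shift h c hc hcy N M hM x a r k hk l hl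
  simp only [cellPts, closePts, Finset.mem_filter] at hl ⊢
  refine ⟨hl.1, ?_⟩
  exact (ciInf_le ⟨0, by rintro _ ⟨k, rfl⟩; exact h.nonneg _⟩ (fun i => -(k i / (M : ℤ)))).trans h1

lemma cells_disj (h : IsNrm nrm) (c : ℝ) (hc : 0 < c) (hcy : ∀ y, nrm y ≤ c * ‖y‖)
    (c' : ℝ) (hc' : 0 < c') (hcy' : ∀ y, ‖y‖ ≤ c' * nrm y)
    (N M : ℕ) (hM : 0 < M) (x : ℕ → Fin d → ℝ) (a : Fin d → ℝ) (r : ℝ) (hr : c' * (2 * r) < 1) :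
    ((cellsMeeting_finite h M a (r - c / M)).toFinset : Set (Fin d → ℤ)).PairwiseDisjoint
      (cellPts d N M x) := by
  intro k hk k' hk' hkk
  simp only [Set.Finite.coe_toFinset] at hk hk'
  apply Finset.disjoint_left.2
  intro l hl hl'
  apply hkk
  have h1 := cell_shift h c hc hcy N M hM x a r k hk l hl
  have h2 := cell_shift h c hc hcy N M hM x a r k' hk' l hl'
  simp only [cellPts, Finset.mem_filter] at hl hl'
  have h3 := h.tri_sub (fun i => x l i - a i - ((-(k i / (M : ℤ)) : ℤ) : ℝ)) 0
    (fun i => x l i - a i - ((-(k' i / (M : ℤ)) : ℤ) : ℝ))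
  rw [sub_zero, zero_sub, h.neg] at h3
  have h4 := (hcy' _).trans (mul_le_mul_of_nonneg_left (h3.trans (add_le_add h1 h2)) hc'.le)
  ext i
  have h5 := (norm_le_pi_norm _ i).trans h4
  rw [Real.norm_eq_abs] at h5
  have h6 : |(((k i / (M : ℤ)) - (k' i / (M : ℤ)) : ℤ) : ℝ)| < 1 := by
    refine lt_of_eq_of_lt ?_ (lt_of_le_of_lt h5 (by linarith))
    simp only [Pi.sub_apply]
    congr 1
    push_cast
    ring
  have h7 : |((k i / (M : ℤ)) - (k' i / (M : ℤ)) : ℤ)| < 1 := by exact_mod_cast h6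
  rw [Int.abs_lt_one_iff] at h7
  have h8 := (hl.2 i).symm.trans (hl'.2 i)
  rw [← Int.emod_add_mul_ediv (k i) M, ← Int.emod_add_mul_ediv (k' i) M, h8,
    sub_eq_zero.1 h7]

end

section
variable {d : ℕ} {nrm : (Fin d → ℝ) → ℝ}

lemma close_card_upper (h : IsNrm nrm) (c : ℝ) (hc : 0 < c) (hcy : ∀ y, nrm y ≤ c * ‖y‖)
    (N M : ℕ) (hN : 0 < N) (hM : 0 < M) (x : ℕ → Fin d → ℝ)
    (hx : ∀ n, ∀ i, x n i ∈ Set.Ico (0 : ℝ) 1) (E : ℝ) (hE0 : 0 ≤ E)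
    (hE : starDiscrepancy d N x ≤ E)
    (a : Fin d → ℝ) (r : ℝ) (hr : 0 < r) :
    ((closePts nrm N x a r).card : ℝ) ≤
      (r + 2 * (c / M)) ^ d * (MeasureTheory.volume {y : Fin d → ℝ | nrm y ≤ 1}).toReal *
        (N * (1 + 2 ^ d * M ^ d * E)) := by
  have hM' : (0 : ℝ) < M := by exact_mod_cast hM
  have hN' : (0 : ℝ) < N := by exact_mod_cast hN
  have hδ : 0 < c / M := by positivity
  have h1 := (Finset.card_le_card (close_upper h N M hM x hx a r (c / M) hδ)).trans
    Finset.card_biUnion_le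
  have h2 : ((closePts nrm N x a r).card : ℝ) ≤
    ∑ k ∈ (cellsMeeting_finite h M a (r + c / M)).toFinset, ((cellPts d N M x k).card : ℝ) := by
    exact_mod_cast h1
  have h3 : ∀ k ∈ (cellsMeeting_finite h M a (r + c / M)).toFinset,
      ((cellPts d N M x k).card : ℝ) ≤ N * (1 / (M : ℝ) ^ d + 2 ^ d * E) := by
    intro k _
    have := (abs_le.1 (cell_bound d N M hM x hx E hE k)).2
    rw [sub_le_iff_le_add, div_le_iff₀ hN'] at this
    linarith
  have h4 := h2.trans (Finset.sum_le_sum h3)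
  rw [Finset.sum_const, nsmul_eq_mul] at h4
  have h5 := cells_upper h c hc hcy M hM a (r + c / M) (by positivity)
  have h6 : (r + c / M + c / M) = r + 2 * (c / M) := by ring
  rw [h6] at h5
  have h7 : (0:ℝ) ≤ (N * (1 + 2 ^ d * M ^ d * E)) := by positivity
  refine h4.trans (le_trans (le_of_eq ?_) (mul_le_mul_of_nonneg_right h5 h7))
  field_simp

lemma close_card_lower (h : IsNrm nrm) (c : ℝ) (hc : 0 < c) (hcy : ∀ y, nrm y ≤ c * ‖y‖)
    (c' : ℝ) (hc' : 0 < c') (hcy' : ∀ y, ‖y‖ ≤ c' * nrm y)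
    (N M : ℕ) (hN : 0 < N) (hM : 0 < M) (x : ℕ → Fin d → ℝ)
    (hx : ∀ n, ∀ i, x n i ∈ Set.Ico (0 : ℝ) 1) (E : ℝ)
    (hE : starDiscrepancy d N x ≤ E) (hE1 : 2 ^ d * M ^ d * E ≤ 1)
    (a : Fin d → ℝ) (r : ℝ) (hr : c / M < r) (hr' : c' * (2 * r) < 1) :
    (r - c / M) ^ d * (MeasureTheory.volume {y : Fin d → ℝ | nrm y ≤ 1}).toReal *
        (N * (1 - 2 ^ d * M ^ d * E)) ≤ ((closePts nrm N x a r).card : ℝ) := by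
  have hM' : (0 : ℝ) < M := by exact_mod_cast hM
  have hN' : (0 : ℝ) < N := by exact_mod_cast hN
  have h1 := Finset.card_le_card (close_lower h c hc hcy N M hM x a r)
  rw [Finset.card_biUnion (cells_disj h c hc hcy c' hc' hcy' N M hM x a r hr')] at h1
  have h2 : ∑ k ∈ (cellsMeeting_finite h M a (r - c / M)).toFinset, ((cellPts d N M x k).card : ℝ)
      ≤ ((closePts nrm N x a r).card : ℝ) := by
    exact_mod_cast h1
  have h3 : ∀ k ∈ (cellsMeeting_finite h M a (r - c / M)).toFinset,
      N * (1 / (M : ℝ) ^ d - 2 ^ d * E) ≤ ((cellPts d N M x k).card : ℝ) := by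
    intro k _
    have := (abs_le.1 (cell_bound d N M hM x hx E hE k)).1
    rw [le_sub_iff_add_le, le_div_iff₀ hN'] at this
    linarith
  have h4 := (Finset.sum_le_sum h3).trans h2
  rw [Finset.sum_const, nsmul_eq_mul] at h4
  have h5 := cells_lower h M hM a (r - c / M) (by linarith)
  have h7 : (0:ℝ) ≤ (N * (1 - 2 ^ d * M ^ d * E)) := mul_nonneg hN'.le (by linarith)
  refine (mul_le_mul_of_nonneg_right h5 h7).trans (le_trans (le_of_eq ?_) h4)
  field_simp

lemma torusDist_zero_le (h : IsNrm nrm) : torusDist nrm (fun _ => 0) ≤ 0 := by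
  refine (ciInf_le ⟨0, by rintro _ ⟨k, rfl⟩; exact h.nonneg _⟩ (fun _ => 0)).trans (le_of_eq ?_)
  rw [h.zero]
  ext i; simp

lemma pairs_eq (nrm : (Fin d → ℝ) → ℝ) (N : ℕ) (x : ℕ → Fin d → ℝ) (r : ℝ) :
    ((((Finset.Icc 1 N) ×ˢ (Finset.Icc 1 N)).filter
            (fun p => p.1 ≠ p.2 ∧
              torusDist nrm (fun i => x p.1 i - x p.2 i) ≤ r)).card : ℝ)
    = ∑ m ∈ Finset.Icc 1 N, (((closePts nrm N x (x m) r).erase m).card : ℝ) := by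
  rw [Finset.card_filter, Finset.sum_product_right]
  push_cast
  refine Finset.sum_congr rfl fun m _ => ?_
  have : (closePts nrm N x (x m) r).erase m = (Finset.Icc 1 N).filter (fun l => l ≠ m ∧
      torusDist nrm (fun i => x l i - x m i) ≤ r) := by
    ext l
    simp only [closePts, Finset.mem_erase, Finset.mem_filter]
    tauto
  rw [this, Finset.card_filter]
  push_cast
  rfl

lemma ratio_bounds (h : IsNrm nrm) (c : ℝ) (hc : 0 < c) (hcy : ∀ y, nrm y ≤ c * ‖y‖)
    (c' : ℝ) (hc' : 0 < c') (hcy' : ∀ y, ‖y‖ ≤ c' * nrm y)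
    (N M : ℕ) (hN : 0 < N) (hM : 0 < M) (x : ℕ → Fin d → ℝ)
    (hx : ∀ n, ∀ i, x n i ∈ Set.Ico (0 : ℝ) 1) (E : ℝ) (hE0 : 0 ≤ E)
    (hE : starDiscrepancy d N x ≤ E) (hE1 : 2 ^ d * M ^ d * E ≤ 1)
    (r : ℝ) (hr : c / M < r) (hr' : c' * (2 * r) < 1) (V : ℝ)
    (hV : V = (MeasureTheory.volume {y : Fin d → ℝ | nrm y ≤ 1}).toReal) :
    (1 - c / M / r) ^ d * (1 - 2 ^ d * M ^ d * E) - 1 / (N * r ^ d * V) ≤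
      ((((Finset.Icc 1 N) ×ˢ (Finset.Icc 1 N)).filter
            (fun p => p.1 ≠ p.2 ∧
              torusDist nrm (fun i => x p.1 i - x p.2 i) ≤ r)).card : ℝ) /
          ((N : ℝ) ^ 2 *
            (MeasureTheory.volume {y : Fin d → ℝ | nrm y ≤ r}).toReal) ∧
      ((((Finset.Icc 1 N) ×ˢ (Finset.Icc 1 N)).filter
            (fun p => p.1 ≠ p.2 ∧
              torusDist nrm (fun i => x p.1 i - x p.2 i) ≤ r)).card : ℝ) /
          ((N : ℝ) ^ 2 *
            (MeasureTheory.volume {y : Fin d → ℝ | nrm y ≤ r}).toReal)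
      ≤ (1 + 2 * (c / M / r)) ^ d * (1 + 2 ^ d * M ^ d * E) := by
  have hM' : (0 : ℝ) < M := by exact_mod_cast hM
  have hN' : (0 : ℝ) < N := by exact_mod_cast hN
  have hδ : 0 < c / M := by positivity
  have hr0 : 0 < r := hδ.trans hr
  have hV0 : 0 < V := hV ▸ h.vol_pos
  rw [pairs_eq, h.vol_eq r hr0, ← hV]
  constructor
  · have h1 : ∀ m ∈ Finset.Icc 1 N, (r - c / M) ^ d * V * (N * (1 - 2 ^ d * M ^ d * E)) - 1 ≤
        (((closePts nrm N x (x m) r).erase m).card : ℝ) := by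
      intro m hm
      have := close_card_lower h c hc hcy c' hc' hcy' N M hN hM x hx E hE hE1 (x m) r hr hr'
      rw [← hV] at this
      have h2 := Finset.pred_card_le_card_erase (s := closePts nrm N x (x m) r) (a := m)
      have h3 : ((closePts nrm N x (x m) r).card : ℝ) ≤
          (((closePts nrm N x (x m) r).erase m).card : ℝ) + 1 := by
        exact_mod_cast Nat.sub_le_iff_le_add.1 h2
      linarith
    have h2 := Finset.sum_le_sum h1
    rw [Finset.sum_const, nsmul_eq_mul, Nat.card_Icc, Nat.add_sub_cancel] at h2
    rw [le_div_iff₀ (by positivity)]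
    refine le_trans (le_of_eq ?_) h2
    have h3 : r - c / M = r * (1 - c / M / r) := by field_simp
    rw [h3, mul_pow]
    generalize (1 - c / M / r) ^ d = A
    field_simp
  · have h1 : ∀ m ∈ Finset.Icc 1 N, (((closePts nrm N x (x m) r).erase m).card : ℝ) ≤
        (r + 2 * (c / M)) ^ d * V * (N * (1 + 2 ^ d * M ^ d * E)) := by
      intro m hm
      have := close_card_upper h c hc hcy N M hN hM x hx E hE0 hE (x m) r hr0
      rw [← hV] at this
      refine le_trans ?_ this
      exact_mod_cast Finset.card_erase_le
    have h2 := Finset.sum_le_sum h1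
    rw [Finset.sum_const, nsmul_eq_mul, Nat.card_Icc, Nat.add_sub_cancel] at h2
    rw [div_le_iff₀ (by positivity)]
    refine le_trans h2 (le_of_eq ?_)
    have h3 : r + 2 * (c / M) = r * (1 + 2 * (c / M / r)) := by field_simp
    rw [h3, mul_pow]
    generalize (1 + 2 * (c / M / r)) ^ d = A
    field_simp

end

theorem stmt6 (d : ℕ) (hd : 1 ≤ d) (nrm : (Fin d → ℝ) → ℝ)
    (hnrm_zero : ∀ y, nrm y = 0 ↔ y = 0)
    (hnrm_smul : ∀ (c : ℝ) (y : Fin d → ℝ), nrm (c • y) = |c| * nrm y)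
    (hnrm_tri : ∀ y w : Fin d → ℝ, nrm (y + w) ≤ nrm y + nrm w)
    (x : ℕ → Fin d → ℝ) (hx : ∀ n, ∀ i, x n i ∈ Set.Ico (0 : ℝ) 1)
    (C : ℝ) (hC : 0 < C)
    (hld : ∀ N : ℕ, 2 ≤ N → starDiscrepancy d N x ≤ C * (Real.log N) ^ d / N) :
    ∀ α : ℝ, 0 < α → α < 1 / (d ^ 2 : ℝ) → ∀ s : ℝ, 0 < s →
      Filter.Tendsto
        (fun N : ℕ =>
          ((((Finset.Icc 1 N) ×ˢ (Finset.Icc 1 N)).filter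
            (fun p => p.1 ≠ p.2 ∧
              torusDist nrm (fun i => x p.1 i - x p.2 i) ≤ s / (N : ℝ) ^ α)).card : ℝ) /
          ((N : ℝ) ^ 2 *
            (MeasureTheory.volume {y : Fin d → ℝ | nrm y ≤ s / (N : ℝ) ^ α}).toReal))
        Filter.atTop (nhds 1) := by
  intro α hα hα' s hs
  have h : IsNrm nrm := ⟨hnrm_zero, hnrm_smul, hnrm_tri⟩
  obtain ⟨c, hc, hcy⟩ := h.upper
  obtain ⟨c', hc', hcy'⟩ := h.lower
  have hd' : (1 : ℝ) ≤ d := by exact_mod_cast hd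
  have hd0 : (0 : ℝ) < d := by linarith
  have hαd : α < 1 / d := hα'.trans_le (one_div_le_one_div_of_le hd0 (by nlinarith))
  obtain ⟨β, hαβ, hβ⟩ := exists_between hαd
  have hβ0 : 0 < β := hα.trans hαβ
  have hβd : β * d < 1 := by rwa [lt_div_iff₀ hd0] at hβ
  have hαd1 : α * d < 1 := by rwa [lt_div_iff₀ hd0] at hαd
  set V := (MeasureTheory.volume {y : Fin d → ℝ | nrm y ≤ 1}).toReal with hV
  have hV0 : 0 < V := h.vol_pos
  set M : ℕ → ℕ := fun N => ⌈(N : ℝ) ^ β⌉₊ with hMdef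
  set E : ℕ → ℝ := fun N => C * (Real.log N) ^ d / N with hEdef
  set r : ℕ → ℝ := fun N => s / (N : ℝ) ^ α with hrdef
  have hcast : Filter.Tendsto (fun N : ℕ => (N : ℝ)) Filter.atTop Filter.atTop :=
    tendsto_natCast_atTop_atTop
  have hneg : ∀ γ : ℝ, 0 < γ → Filter.Tendsto (fun N : ℕ => (N : ℝ) ^ (-γ)) Filter.atTop (nhds 0) :=
    fun γ hγ => (tendsto_rpow_neg_atTop hγ).comp hcast
  have hN1 : ∀ᶠ N : ℕ in Filter.atTop, 2 ≤ N := Filter.eventually_ge_atTop 2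
  -- r → 0
  have hr0 : Filter.Tendsto r Filter.atTop (nhds 0) := by
    have := (hneg α hα).const_mul s
    rw [mul_zero] at this
    refine this.congr fun N => ?_
    rw [hrdef, Real.rpow_neg (by positivity)]
    rfl
  -- δ / r → 0
  have hδr : Filter.Tendsto (fun N => c / M N / r N) Filter.atTop (nhds 0) := by
    have h1 := (hneg (β - α) (by linarith)).const_mul (c / s)
    rw [mul_zero] at h1
    refine squeeze_zero' ?_ ?_ h1
    · filter_upwards with N
      simp only [hrdef]
      positivity
    · filter_upwards [hN1] with N hN
      have hN' : (0 : ℝ) < N := by positivity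
      have hNβ : (0 : ℝ) < (N : ℝ) ^ β := by positivity
      have hNα : (0 : ℝ) < (N : ℝ) ^ α := by positivity
      have h2 : (N : ℝ) ^ β ≤ M N := Nat.le_ceil _
      have h3 : c / M N / r N ≤ c / (N : ℝ) ^ β / r N := by
        have : 0 < r N := by simp only [hrdef]; positivity
        gcongr
      refine h3.trans (le_of_eq ?_)
      rw [neg_sub, Real.rpow_sub hN']
      simp only [hrdef]
      field_simp
  -- η → 0
  have hη : Filter.Tendsto (fun N => (2 : ℝ) ^ d * (M N : ℝ) ^ d * E N) Filter.atTop (nhds 0) := by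
    have h0 : Filter.Tendsto (fun N : ℕ => Real.log N ^ d / (N : ℝ) ^ (1 - β * d)) Filter.atTop (nhds 0) := by
      have := (isLittleO_log_rpow_rpow_atTop (d : ℝ) (show 0 < 1 - β * d by linarith)).tendsto_div_nhds_zero
      refine (this.comp hcast).congr fun N => ?_
      simp [Real.rpow_natCast]
    have h1 := h0.const_mul ((2 : ℝ) ^ d * 2 ^ d * C)
    rw [mul_zero] at h1
    refine squeeze_zero' ?_ ?_ h1
    · filter_upwards [hN1] with N hN
      have : 0 ≤ Real.log N := Real.log_natCast_nonneg N
      simp only [hEdef]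
      positivity
    · filter_upwards [hN1] with N hN
      have hN' : (0 : ℝ) < N := by positivity
      have hl : 0 ≤ Real.log N := Real.log_natCast_nonneg N
      have hNβ : (1 : ℝ) ≤ (N : ℝ) ^ β := Real.one_le_rpow (by exact_mod_cast (by omega : 1 ≤ N)) hβ0.le
      have h2 : (M N : ℝ) ≤ 2 * (N : ℝ) ^ β := by
        have := Nat.ceil_lt_add_one (show 0 ≤ (N : ℝ) ^ β by positivity)
        simp only [hMdef]
        linarith
      have hE0 : 0 ≤ E N := by simp only [hEdef]; positivity
      have h3 : (2 : ℝ) ^ d * (M N : ℝ) ^ d * E N ≤ (2 : ℝ) ^ d * (2 * (N : ℝ) ^ β) ^ d * E N := by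
        gcongr
      refine h3.trans (le_of_eq ?_)
      rw [Real.rpow_sub hN', Real.rpow_one, Real.rpow_mul hN'.le, Real.rpow_natCast, mul_pow]
      simp only [hEdef]
      field_simp
  -- diagonal
  have hdiag : Filter.Tendsto (fun N : ℕ => 1 / (N * r N ^ d * V)) Filter.atTop (nhds 0) := by
    have h1 := (hneg (1 - α * d) (by linarith)).const_mul (1 / (s ^ d * V))
    rw [mul_zero] at h1
    refine h1.congr' ?_
    filter_upwards [hN1] with N hN
    have hN' : (0 : ℝ) < N := by positivity
    rw [neg_sub, Real.rpow_sub hN', Real.rpow_one, Real.rpow_mul hN'.le, Real.rpow_natCast]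
    simp only [hrdef, div_pow]
    have hNα : (0 : ℝ) < (N : ℝ) ^ α := by positivity
    field_simp
  have hlow : Filter.Tendsto (fun N : ℕ => (1 - c / M N / r N) ^ d * (1 - 2 ^ d * (M N : ℝ) ^ d * E N)
      - 1 / (N * r N ^ d * V)) Filter.atTop (nhds 1) := by
    have := (((hδr.const_sub 1).pow d).mul (hη.const_sub 1)).sub hdiag
    simpa using this
  have hup : Filter.Tendsto (fun N : ℕ => (1 + 2 * (c / M N / r N)) ^ d *
      (1 + 2 ^ d * (M N : ℝ) ^ d * E N)) Filter.atTop (nhds 1) := by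
    have := ((((hδr.const_mul 2).const_add 1).pow d).mul (hη.const_add 1))
    simpa using this
  have hr2 : ∀ᶠ N in Filter.atTop, c' * (2 * r N) < 1 := by
    have := (hr0.const_mul 2).const_mul c'
    simp only [mul_zero] at this
    exact this.eventually (gt_mem_nhds one_pos)
  have hall : ∀ᶠ N : ℕ in Filter.atTop, 2 ≤ N ∧ 0 < N ∧ 0 < M N ∧ 0 ≤ E N ∧
      2 ^ d * (M N : ℝ) ^ d * E N ≤ 1 ∧ c / M N < r N ∧ c' * (2 * r N) < 1 := by
    filter_upwards [hN1, hr2, hδr.eventually (gt_mem_nhds one_pos),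
      hη.eventually (gt_mem_nhds one_pos)] with N hN h2 h3 h4
    have hN' : (0 : ℝ) < N := by positivity
    have hl : 0 ≤ Real.log N := Real.log_natCast_nonneg N
    have hM0 : 0 < M N := Nat.ceil_pos.2 (by positivity)
    have hrN : 0 < r N := by simp only [hrdef]; positivity
    exact ⟨hN, by omega, hM0, by simp only [hEdef]; positivity, h4.le,
      by rwa [div_lt_one hrN] at h3, h2⟩
  refine tendsto_of_tendsto_of_tendsto_of_le_of_le' hlow hup ?_ ?_
  · filter_upwards [hall] with N ⟨h2, h0, hM, hE0, hE1, hr, hr'⟩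
    exact (ratio_bounds h c hc hcy c' hc' hcy' N (M N) h0 hM x hx (E N) hE0 (hld N h2) hE1
      (r N) hr hr' V hV).1
  · filter_upwards [hall] with N ⟨h2, h0, hM, hE0, hE1, hr, hr'⟩
    exact (ratio_bounds h c hc hcy c' hc' hcy' N (M N) h0 hM x hx (E N) hE0 (hld N h2) hE1
      (r N) hr hr' V hV).2
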